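/- Let p : [0,1) → ℝ be integrable, let y : [0,1) → ℝ be integrable with finite modulus of continuity ω_n y, let ξ ∈ [0,1) and n ∈ ℕ, n ≥ 1. Then for every x ∈ [0,1): | S_{2^n}( ∫_ξ^{·} S_{2^n}p(t)·(y(t) − S_{2^n}y(t)) dt )(x) | ≤ 2 · max_{0 ≤ i < 2^n} { 2^{-n} |S_{2^n}p(i/2^n)| } · ω_n y. -/

import Mathlib

open MeasureTheory Matrix

/-- The `k`-th binary digit of `x ∈ [0,1)`, using the expansion terminating in zeros
for dyadic rationals. -/
noncomputable def binDigit (k : ℕ) (x : ℝ) : ℕ := ⌊x * 2 ^ (k + 1)⌋.toNat % 2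

/-- Rademacher functions `r_k(x) = (-1)^{x_k}`. -/
noncomputable def rademacher (k : ℕ) (x : ℝ) : ℝ := (-1 : ℝ) ^ binDigit k x

/-- Walsh–Paley functions `ω_n(x) = ∏_k r_k(x)^{n_k}`. -/
noncomputable def walsh (n : ℕ) (x : ℝ) : ℝ :=
  ∏ k ∈ Finset.range n, if n.testBit k then rademacher k x else 1

/-- Walsh–Fourier coefficient `f̂_k = ∫₀¹ f ω_k`. -/
noncomputable def fcoef (f : ℝ → ℝ) (k : ℕ) : ℝ := ∫ x in (0:ℝ)..1, f x * walsh k x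

/-- The `2^n`-th partial sum of the Walsh–Fourier series:
`S_{2^n} f (x) = ∑_{k<2^n} f̂_k ω_k(x)`. -/
noncomputable def S2 (n : ℕ) (f : ℝ → ℝ) (x : ℝ) : ℝ :=
  ∑ k ∈ Finset.range (2 ^ n), fcoef f k * walsh k x

/-- Dyadic addition `x ∔ y`: bitwise XOR of the binary expansions. -/
noncomputable def dyadicAdd (x y : ℝ) : ℝ :=
  ∑' k : ℕ, (((binDigit k x + binDigit k y) % 2 : ℕ) : ℝ) / 2 ^ (k + 1)

/-- The set of values `|f(x ∔ h) − f(x)|`, `x ∈ [0,1)`, `0 ≤ h < 2^{-n}`. -/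
def modSet (n : ℕ) (f : ℝ → ℝ) : Set ℝ :=
  {r | ∃ x ∈ Set.Ico (0:ℝ) 1, ∃ h : ℝ, 0 ≤ h ∧ h < 1 / 2 ^ n ∧
    r = |f (dyadicAdd x h) - f x|}

/-- The (dyadic) modulus of continuity `ω_n f`. -/
noncomputable def omegaMod (n : ℕ) (f : ℝ → ℝ) : ℝ := sSup (modSet n f)

/-- The set of values `∫₀¹ |f(x ∔ h) − f(x)| dx`, `0 ≤ h < 2^{-n}`. -/
def intModSet (n : ℕ) (f : ℝ → ℝ) : Set ℝ :=
  {r | ∃ h : ℝ, 0 ≤ h ∧ h < 1 / 2 ^ n ∧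
    r = ∫ x in (0:ℝ)..1, |f (dyadicAdd x h) - f x|}

/-- The integral modulus of continuity `ω^{(1)}_n f`. -/
noncomputable def omega1 (n : ℕ) (f : ℝ → ℝ) : ℝ := sSup (intModSet n f)

/-- The supremum norm `‖f‖_∞ = sup_{x ∈ [0,1)} |f x|`. -/
noncomputable def supNorm (f : ℝ → ℝ) : ℝ := sSup ((fun x => |f x|) '' Set.Ico 0 1)

lemma binDigit_eq_floor_mod (k : ℕ) (x : ℝ) : binDigit k x = ⌊x * 2 ^ (k + 1)⌋₊ % 2 := by
  rw [binDigit, Int.floor_toNat]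

lemma binDigit_lt_two (k : ℕ) (x : ℝ) : binDigit k x < 2 := Nat.mod_lt _ two_pos

/-- Appending one binary digit to the integer part of `x * 2 ^ n`. -/
lemma floor_mul_two_pow_succ (n : ℕ) (x : ℝ) :
    ⌊x * 2 ^ (n + 1)⌋₊ = 2 * ⌊x * 2 ^ n⌋₊ + binDigit n x := by
  have h : ⌊x * 2 ^ n⌋₊ = ⌊x * 2 ^ (n + 1)⌋₊ / 2 := by
    rw [← Nat.floor_div_ofNat]
    congr 1
    rw [pow_succ]
    simp [← mul_assoc]
  rw [h, binDigit_eq_floor_mod]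
  omega

lemma measurable_rademacher (k : ℕ) : Measurable (rademacher k) := by
  have h : Measurable (binDigit k) := by
    have : binDigit k = (fun m : ℕ => m % 2) ∘ fun x : ℝ => ⌊x * 2 ^ (k + 1)⌋₊ :=
      funext fun x => binDigit_eq_floor_mod k x
    rw [this]
    exact measurable_from_top.comp (Nat.measurable_floor.comp (by fun_prop))
  exact (measurable_from_top (f := fun m : ℕ => (-1 : ℝ) ^ m)).comp h

lemma abs_rademacher (k : ℕ) (x : ℝ) : |rademacher k x| = 1 := by
  simp [rademacher]

lemma measurable_walsh (n : ℕ) : Measurable (walsh n) := by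
  refine Finset.measurable_prod _ fun k _ => ?_
  split_ifs
  · exact measurable_rademacher k
  · exact measurable_const

lemma abs_walsh (n : ℕ) (x : ℝ) : |walsh n x| = 1 := by
  rw [walsh, Finset.abs_prod]
  refine Finset.prod_eq_one fun k _ => ?_
  split_ifs <;> simp [abs_rademacher]

lemma walsh_eq_prod_range {n N : ℕ} (h : n < 2 ^ N) (x : ℝ) :
    walsh n x = ∏ k ∈ Finset.range N, if n.testBit k then rademacher k x else 1 := by
  have extend : ∀ {A B : ℕ}, A ≤ B → n < 2 ^ A →
      (∏ k ∈ Finset.range A, if n.testBit k then rademacher k x else 1) =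
        ∏ k ∈ Finset.range B, if n.testBit k then rademacher k x else 1 := by
    intro A B hAB hA
    refine Finset.prod_subset (Finset.range_mono hAB) fun k _ hk => ?_
    have hk' : A ≤ k := by simpa using hk
    rw [Nat.testBit_eq_false_of_lt (hA.trans_le (Nat.pow_le_pow_right two_pos hk'))]
    simp
  rcases le_total n N with hnN | hnN
  · exact extend hnN Nat.lt_two_pow_self
  · exact (extend hnN h).symm

lemma walsh_two_pow_add {n k : ℕ} (hk : k < 2 ^ n) (x : ℝ) :
    walsh (2 ^ n + k) x = walsh k x * rademacher n x := by
  have hlt : 2 ^ n + k < 2 ^ (n + 1) := by rw [pow_succ]; omega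
  rw [walsh_eq_prod_range hlt, walsh_eq_prod_range hk, Finset.prod_range_succ]
  congr 1
  · refine Finset.prod_congr rfl fun i hi => ?_
    rw [Nat.testBit_two_pow_add_gt (Finset.mem_range.mp hi)]
  · rw [Nat.testBit_two_pow_add_eq, Nat.testBit_eq_false_of_lt hk]
    simp

/-- The Walsh–Dirichlet kernel of order `2 ^ n`. -/
lemma sum_walsh_mul_walsh (n : ℕ) {t x : ℝ} (ht : t ∈ Set.Ico (0 : ℝ) 1)
    (hx : x ∈ Set.Ico (0 : ℝ) 1) :
    ∑ k ∈ Finset.range (2 ^ n), walsh k t * walsh k x =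
      if ⌊t * 2 ^ n⌋₊ = ⌊x * 2 ^ n⌋₊ then 2 ^ n else 0 := by
  induction n with
  | zero =>
    simp [walsh, Nat.floor_eq_zero.mpr ht.2, Nat.floor_eq_zero.mpr hx.2]
  | succ n ih =>
    have hsum : ∑ k ∈ Finset.range (2 ^ n), walsh (2 ^ n + k) t * walsh (2 ^ n + k) x =
        (∑ k ∈ Finset.range (2 ^ n), walsh k t * walsh k x) *
          (rademacher n t * rademacher n x) := by
      rw [Finset.sum_mul]
      refine Finset.sum_congr rfl fun k hk => ?_
      rw [walsh_two_pow_add (Finset.mem_range.mp hk), walsh_two_pow_add (Finset.mem_range.mp hk)]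
      ring
    rw [pow_succ 2 n, mul_two, Finset.sum_range_add, hsum, ih,
      floor_mul_two_pow_succ n t, floor_mul_two_pow_succ n x, rademacher, rademacher]
    have h1 := binDigit_lt_two n t
    have h2 := binDigit_lt_two n x
    generalize binDigit n t = a at *
    generalize binDigit n x = b at *
    generalize ⌊t * 2 ^ n⌋₊ = u
    generalize ⌊x * 2 ^ n⌋₊ = v
    by_cases huv : u = v
    · subst huv
      interval_cases a <;> interval_cases b <;> simp <;> ring
    · have : ¬ 2 * u + a = 2 * v + b := by omega
      simp [huv, this]

lemma floor_eq_of_mem_Ico {n j : ℕ} {t : ℝ}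
    (ht : t ∈ Set.Ico ((j : ℝ) / 2 ^ n) ((j + 1) / 2 ^ n)) : ⌊t * 2 ^ n⌋₊ = j := by
  have h2 : (0 : ℝ) < 2 ^ n := by positivity
  have h0 : 0 ≤ t := le_trans (by positivity) ht.1
  rw [Nat.floor_eq_iff (by positivity)]
  exact ⟨(div_le_iff₀ h2).mp ht.1, (lt_div_iff₀ h2).mp ht.2⟩

lemma mem_Ico_floor (n : ℕ) {t : ℝ} (ht : 0 ≤ t) :
    t ∈ Set.Ico ((⌊t * 2 ^ n⌋₊ : ℝ) / 2 ^ n) ((⌊t * 2 ^ n⌋₊ + 1) / 2 ^ n) := by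
  have h2 : (0 : ℝ) < 2 ^ n := by positivity
  exact ⟨(div_le_iff₀ h2).mpr (Nat.floor_le (by positivity)),
    (lt_div_iff₀ h2).mpr (Nat.lt_floor_add_one _)⟩

lemma floor_lt_two_pow (n : ℕ) {t : ℝ} (ht : t ∈ Set.Ico (0 : ℝ) 1) : ⌊t * 2 ^ n⌋₊ < 2 ^ n := by
  have h2 : (0 : ℝ) < 2 ^ n := by positivity
  rw [Nat.floor_lt (mul_nonneg ht.1 h2.le)]
  push_cast
  nlinarith [ht.2]

lemma dyadic_Ico_subset {n j : ℕ} (hj : j < 2 ^ n) :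
    Set.Ico ((j : ℝ) / 2 ^ n) ((j + 1) / 2 ^ n) ⊆ Set.Ico 0 1 := by
  have h : (j : ℝ) + 1 ≤ 2 ^ n := by exact_mod_cast hj
  exact Set.Ico_subset_Ico (by positivity) ((div_le_one (by positivity)).mpr h)

lemma integrableOn_mul_walsh {f : ℝ → ℝ} (hf : IntegrableOn f (Set.Ico (0 : ℝ) 1)) (k : ℕ) :
    IntegrableOn (fun t => f t * walsh k t) (Set.Ico (0 : ℝ) 1) :=
  hf.mul_bdd (c := 1) (measurable_walsh k).aestronglyMeasurable
    (Filter.Eventually.of_forall fun t => by rw [Real.norm_eq_abs, abs_walsh])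

/-- The partial sum `S_{2^n} f` averages `f` over the dyadic intervals of length `2 ^ (-n)`. -/
lemma S2_eq_integral {f : ℝ → ℝ} (hf : IntegrableOn f (Set.Ico (0 : ℝ) 1)) {n j : ℕ}
    (hj : j < 2 ^ n) {x : ℝ} (hx : x ∈ Set.Ico ((j : ℝ) / 2 ^ n) ((j + 1) / 2 ^ n)) :
    S2 n f x = 2 ^ n * ∫ t in ((j : ℝ) / 2 ^ n)..((j + 1) / 2 ^ n), f t := by
  have hsub := dyadic_Ico_subset hj
  calc S2 n f x = ∑ k ∈ Finset.range (2 ^ n),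
        ∫ t in Set.Ico (0 : ℝ) 1, f t * walsh k t * walsh k x := by
        refine Finset.sum_congr rfl fun k _ => ?_
        rw [fcoef, intervalIntegral.integral_of_le zero_le_one, ← integral_Ico_eq_integral_Ioc,
          integral_mul_const]
    _ = ∫ t in Set.Ico (0 : ℝ) 1,
        ∑ k ∈ Finset.range (2 ^ n), f t * walsh k t * walsh k x := by
        rw [integral_finsetSum]
        exact fun k _ => (integrableOn_mul_walsh hf k).mul_const _
    _ = ∫ t in Set.Ico (0 : ℝ) 1,
        (Set.Ico ((j : ℝ) / 2 ^ n) ((j + 1) / 2 ^ n)).indicator (fun t => 2 ^ n * f t) t := by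
        refine setIntegral_congr_fun measurableSet_Ico fun t ht => ?_
        simp only [mul_assoc]
        rw [← Finset.mul_sum, sum_walsh_mul_walsh n ht (hsub hx), floor_eq_of_mem_Ico hx]
        by_cases h : t ∈ Set.Ico ((j : ℝ) / 2 ^ n) ((j + 1) / 2 ^ n)
        · rw [Set.indicator_of_mem h, if_pos (floor_eq_of_mem_Ico h), mul_comm]
        · rw [Set.indicator_of_notMem h, if_neg, mul_zero]
          rintro rfl
          exact h (mem_Ico_floor n ht.1)
    _ = _ := by
        rw [setIntegral_indicator measurableSet_Ico, Set.inter_eq_right.mpr hsub,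
          integral_const_mul, integral_Ico_eq_integral_Ioc,
          ← intervalIntegral.integral_of_le (by gcongr; linarith)]

lemma measurable_S2 (n : ℕ) (f : ℝ → ℝ) : Measurable (S2 n f) :=
  Finset.measurable_sum _ fun k _ => (measurable_walsh k).const_mul _

lemma abs_S2_le (n : ℕ) (f : ℝ → ℝ) (x : ℝ) :
    |S2 n f x| ≤ ∑ k ∈ Finset.range (2 ^ n), |fcoef f k| := by
  refine (Finset.abs_sum_le_sum_abs _ _).trans (Finset.sum_le_sum fun k _ => ?_)
  rw [abs_mul, abs_walsh, mul_one]

lemma sum_binDigit_div (n : ℕ) {x : ℝ} (hx : x ∈ Set.Ico (0 : ℝ) 1) :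
    ∑ k ∈ Finset.range n, (binDigit k x : ℝ) / 2 ^ (k + 1) = (⌊x * 2 ^ n⌋₊ : ℝ) / 2 ^ n := by
  induction n with
  | zero => simp [Nat.floor_eq_zero.mpr hx.2]
  | succ n ih =>
    rw [Finset.sum_range_succ, ih, floor_mul_two_pow_succ]
    push_cast
    field_simp
    ring

/-- Dyadic addition of `t - j / 2 ^ n` moves `t` to the left endpoint of its dyadic interval. -/
lemma dyadicAdd_sub_left_endpoint {n j : ℕ} (hj : j < 2 ^ n) {t : ℝ}
    (ht : t ∈ Set.Ico ((j : ℝ) / 2 ^ n) ((j + 1) / 2 ^ n)) :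
    dyadicAdd t (t - j / 2 ^ n) = j / 2 ^ n := by
  have hlow : ∀ k < n, binDigit k (t - j / 2 ^ n) = 0 := by
    intro k hk
    have hpow : (2 : ℝ) ^ (k + 1) ≤ 2 ^ n := pow_le_pow_right₀ one_le_two hk
    have hlt : (t - j / 2 ^ n) * 2 ^ n < 1 := by
      have := ht.2
      rw [add_div] at this
      rw [← lt_div_iff₀ (by positivity)]
      linarith
    have : (t - j / 2 ^ n) * 2 ^ (k + 1) < 1 :=
      (mul_le_mul_of_nonneg_left hpow (sub_nonneg.mpr ht.1)).trans_lt hlt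
    rw [binDigit_eq_floor_mod, Nat.floor_eq_zero.mpr this]
  have hhigh : ∀ k, n ≤ k → binDigit k (t - j / 2 ^ n) = binDigit k t := by
    intro k hk
    obtain ⟨d, rfl⟩ := Nat.exists_eq_add_of_le hk
    have : t * 2 ^ (n + d + 1) =
        (t - j / 2 ^ n) * 2 ^ (n + d + 1) + ((2 * (j * 2 ^ d) : ℕ) : ℝ) := by
      push_cast
      field_simp
      ring
    have hnn : 0 ≤ (t - j / 2 ^ n) * 2 ^ (n + d + 1) :=
      mul_nonneg (sub_nonneg.mpr ht.1) (by positivity)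
    rw [binDigit_eq_floor_mod, binDigit_eq_floor_mod, this, Nat.floor_add_natCast hnn]
    omega
  rw [dyadicAdd, tsum_eq_sum (s := Finset.range n)]
  · have hsum := sum_binDigit_div n (dyadic_Ico_subset hj ht)
    rw [floor_eq_of_mem_Ico ht] at hsum
    refine Eq.trans ?_ hsum
    refine Finset.sum_congr rfl fun k hk => ?_
    rw [hlow k (Finset.mem_range.mp hk), add_zero, Nat.mod_eq_of_lt (binDigit_lt_two k t)]
  · intro k hk
    rw [hhigh k (by simpa using hk), ← two_mul, Nat.mul_mod_right]
    simp

lemma omegaMod_nonneg (n : ℕ) (f : ℝ → ℝ) : 0 ≤ omegaMod n f :=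
  Real.sSup_nonneg fun _ ⟨_, _, _, _, _, hr⟩ => hr ▸ abs_nonneg _

lemma abs_sub_left_endpoint_le_omegaMod {f : ℝ → ℝ} {n j : ℕ} (hf : BddAbove (modSet n f))
    (hj : j < 2 ^ n) {t : ℝ} (ht : t ∈ Set.Ico ((j : ℝ) / 2 ^ n) ((j + 1) / 2 ^ n)) :
    |f t - f (j / 2 ^ n)| ≤ omegaMod n f := by
  refine le_csSup hf ⟨t, dyadic_Ico_subset hj ht, t - j / 2 ^ n, sub_nonneg.mpr ht.1, ?_, ?_⟩
  · have := ht.2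
    rw [add_div] at this
    linarith
  · rw [dyadicAdd_sub_left_endpoint hj ht, abs_sub_comm]

lemma intervalIntegrable_of_mem_Icc {f : ℝ → ℝ} (hf : IntegrableOn f (Set.Ico (0 : ℝ) 1))
    {a b : ℝ} (ha : a ∈ Set.Icc (0 : ℝ) 1) (hb : b ∈ Set.Icc (0 : ℝ) 1) :
    IntervalIntegrable f volume a b := by
  have h : IntegrableOn f (Set.Icc (0 : ℝ) 1) := (integrableOn_Icc_iff_integrableOn_Ico).mpr hf
  exact (h.mono_set (Set.uIcc_subset_Icc ha hb)).intervalIntegrable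

/-- On an initial piece of an interval, a function staying within `ω` of a constant has an
integral within `(b - a) * ω / 2` of the corresponding share of its total integral. -/
lemma abs_integral_sub_average_le {f : ℝ → ℝ} {a b s c ω : ℝ} (hab : a < b)
    (hs : s ∈ Set.Icc a b) (has : IntervalIntegrable f volume a s)
    (hsb : IntervalIntegrable f volume s b) (hω : ∀ t ∈ Set.Ico a b, |f t - c| ≤ ω) :
    |(∫ t in a..s, f t) - (s - a) / (b - a) * ∫ t in a..b, f t| ≤ (b - a) * ω / 2 := by
  have hω0 : 0 ≤ ω := (abs_nonneg _).trans (hω a ⟨le_rfl, hab⟩)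
  have bound : ∀ u v, a ≤ u → u ≤ v → v ≤ b → IntervalIntegrable f volume u v →
      |(∫ t in u..v, f t) - (v - u) * c| ≤ ω * (v - u) := by
    intro u v hau huv hvb hint
    have h1 : (∫ t in u..v, f t) - (v - u) * c = ∫ t in u..v, (f t - c) := by
      rw [intervalIntegral.integral_sub hint intervalIntegrable_const]
      simp
    rw [h1, ← abs_of_nonneg (sub_nonneg.mpr huv), ← Real.norm_eq_abs]
    refine intervalIntegral.norm_integral_le_of_norm_le_const_ae ?_
    have hne : ∀ᵐ t : ℝ, t ≠ v := by simp [ae_iff]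
    filter_upwards [hne] with t htv ht
    rw [Set.uIoc_of_le huv] at ht
    exact hω t ⟨hau.trans ht.1.le, (lt_of_le_of_ne ht.2 htv).trans_le hvb⟩
  have hA := bound a s le_rfl hs.1 hs.2 has
  have hB := bound s b hs.1 hs.2 le_rfl hsb
  rw [← intervalIntegral.integral_add_adjacent_intervals has hsb]
  generalize (∫ t in a..s, f t) = A at *
  generalize (∫ t in s..b, f t) = B at *
  have hL : 0 < b - a := sub_pos.mpr hab
  have hsa : 0 ≤ s - a := sub_nonneg.mpr hs.1
  have hbs : 0 ≤ b - s := sub_nonneg.mpr hs.2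
  have key : A - (s - a) / (b - a) * (A + B) =
      ((b - s) * (A - (s - a) * c) - (s - a) * (B - (b - s) * c)) / (b - a) := by
    field_simp
    ring
  rw [key, abs_div, abs_of_pos hL, div_le_iff₀ hL]
  calc _ ≤ |(b - s) * (A - (s - a) * c)| + |(s - a) * (B - (b - s) * c)| := abs_sub _ _
    _ ≤ (b - s) * (ω * (s - a)) + (s - a) * (ω * (b - s)) := by
        rw [abs_mul, abs_mul, abs_of_nonneg hbs, abs_of_nonneg hsa]
        gcongr
    _ ≤ _ := by nlinarith [mul_nonneg hω0 (sq_nonneg ((b - s) - (s - a)))]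

/-- On a dyadic interval the factor `S2 n p` is constant. -/
lemma integral_S2_mul_sub_S2 {p y : ℝ → ℝ} (hp : IntegrableOn p (Set.Ico (0 : ℝ) 1))
    (hy : IntegrableOn y (Set.Ico (0 : ℝ) 1)) {n j : ℕ} (hj : j < 2 ^ n) {s : ℝ}
    (hs : s ∈ Set.Icc ((j : ℝ) / 2 ^ n) ((j + 1) / 2 ^ n)) :
    ∫ t in ((j : ℝ) / 2 ^ n)..s, S2 n p t * (y t - S2 n y t) =
      S2 n p (j / 2 ^ n) * ((∫ t in ((j : ℝ) / 2 ^ n)..s, y t) -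
        (s - j / 2 ^ n) / ((j + 1) / 2 ^ n - j / 2 ^ n) *
          ∫ t in ((j : ℝ) / 2 ^ n)..((j + 1) / 2 ^ n), y t) := by
  have hlt : (j : ℝ) / 2 ^ n < (j + 1) / 2 ^ n := by gcongr; linarith
  have hb : ((j : ℝ) + 1) / 2 ^ n ≤ 1 := by
    rw [div_le_one (by positivity)]
    exact_mod_cast hj
  have ha : (0 : ℝ) ≤ j / 2 ^ n := by positivity
  have hL : ((j : ℝ) + 1) / 2 ^ n - j / 2 ^ n = 1 / 2 ^ n := by ring
  have hint : IntervalIntegrable y volume (j / 2 ^ n) s :=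
    intervalIntegrable_of_mem_Icc hy ⟨ha, hlt.le.trans hb⟩ ⟨ha.trans hs.1, hs.2.trans hb⟩
  have hne : ∀ᵐ t : ℝ, t ≠ s := by simp [ae_iff]
  rw [intervalIntegral.integral_congr_ae (g := fun t => S2 n p (j / 2 ^ n) *
    (y t - 2 ^ n * ∫ u in ((j : ℝ) / 2 ^ n)..((j + 1) / 2 ^ n), y u))]
  · rw [intervalIntegral.integral_const_mul,
      intervalIntegral.integral_sub hint intervalIntegrable_const, hL]
    simp only [intervalIntegral.integral_const, smul_eq_mul]
    field_simp
  · filter_upwards [hne] with t hts ht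
    rw [Set.uIoc_of_le hs.1] at ht
    have htI : t ∈ Set.Ico ((j : ℝ) / 2 ^ n) ((j + 1) / 2 ^ n) :=
      ⟨ht.1.le, (lt_of_le_of_ne ht.2 hts).trans_le hs.2⟩
    rw [S2_eq_integral hp hj htI, S2_eq_integral hp hj ⟨le_rfl, hlt⟩, S2_eq_integral hy hj htI]

lemma integrableOn_S2_mul_sub_S2 (p : ℝ → ℝ) {y : ℝ → ℝ}
    (hy : IntegrableOn y (Set.Ico (0 : ℝ) 1)) (n : ℕ) :
    IntegrableOn (fun t => S2 n p t * (y t - S2 n y t)) (Set.Ico (0 : ℝ) 1) := by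
  have hS : IntegrableOn (S2 n y) (Set.Ico (0 : ℝ) 1) :=
    Measure.integrableOn_of_bounded (by simp) (measurable_S2 n y).aestronglyMeasurable
      (Filter.Eventually.of_forall fun t => abs_S2_le n y t)
  exact (hy.sub hS).bdd_mul (measurable_S2 n p).aestronglyMeasurable
    (Filter.Eventually.of_forall fun t => abs_S2_le n p t)

lemma integral_dyadic_S2_mul_sub_S2_eq_zero {p y : ℝ → ℝ}
    (hp : IntegrableOn p (Set.Ico (0 : ℝ) 1)) (hy : IntegrableOn y (Set.Ico (0 : ℝ) 1)) (n : ℕ)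
    {j : ℕ} (hj : j ≤ 2 ^ n) :
    ∫ t in (0 : ℝ)..(j / 2 ^ n), S2 n p t * (y t - S2 n y t) = 0 := by
  induction j with
  | zero => simp
  | succ j ih =>
    have hlt : (j : ℝ) / 2 ^ n < (j + 1) / 2 ^ n := by gcongr; linarith
    have hmem : ∀ i : ℕ, i ≤ 2 ^ n → (i : ℝ) / 2 ^ n ∈ Set.Icc (0 : ℝ) 1 := fun i hi =>
      ⟨by positivity, (div_le_one (by positivity)).mpr (by exact_mod_cast hi)⟩
    have hg := integrableOn_S2_mul_sub_S2 p hy n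
    rw [← intervalIntegral.integral_add_adjacent_intervals
      (intervalIntegrable_of_mem_Icc hg ⟨le_rfl, zero_le_one⟩ (hmem j (by omega)))
      (intervalIntegrable_of_mem_Icc hg (hmem j (by omega)) (hmem (j + 1) hj)),
      ih (by omega), zero_add, Nat.cast_add_one,
      integral_S2_mul_sub_S2 hp hy hj ⟨hlt.le, le_rfl⟩, div_self (sub_pos.mpr hlt).ne']
    simp

lemma abs_integral_S2_mul_sub_S2_le {p y : ℝ → ℝ} (hp : IntegrableOn p (Set.Ico (0 : ℝ) 1))
    (hy : IntegrableOn y (Set.Ico (0 : ℝ) 1)) {n : ℕ} (hbdd : BddAbove (modSet n y)) {M : ℝ}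
    (hM : ∀ i : ℕ, i < 2 ^ n → |S2 n p ((i : ℝ) / 2 ^ n)| / 2 ^ n ≤ M) {s : ℝ}
    (hs : s ∈ Set.Ico (0 : ℝ) 1) :
    |∫ t in (0 : ℝ)..s, S2 n p t * (y t - S2 n y t)| ≤ M * omegaMod n y := by
  have hj := floor_lt_two_pow n hs
  have hsI := mem_Ico_floor n hs.1
  generalize ⌊s * 2 ^ n⌋₊ = j at *
  have hlt : (j : ℝ) / 2 ^ n < (j + 1) / 2 ^ n := by gcongr; linarith
  have hb : ((j : ℝ) + 1) / 2 ^ n ≤ 1 := by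
    rw [div_le_one (by positivity)]
    exact_mod_cast hj
  have ha : (j : ℝ) / 2 ^ n ∈ Set.Icc (0 : ℝ) 1 := ⟨by positivity, hlt.le.trans hb⟩
  have hs' := Set.Ico_subset_Icc_self hs
  have hg := integrableOn_S2_mul_sub_S2 p hy n
  have hω := omegaMod_nonneg n y
  rw [← intervalIntegral.integral_add_adjacent_intervals
    (intervalIntegrable_of_mem_Icc hg ⟨le_rfl, zero_le_one⟩ ha)
    (intervalIntegrable_of_mem_Icc hg ha hs'),
    integral_dyadic_S2_mul_sub_S2_eq_zero hp hy n hj.le, zero_add,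
    integral_S2_mul_sub_S2 hp hy hj (Set.Ico_subset_Icc_self hsI), abs_mul]
  have key := abs_integral_sub_average_le hlt (Set.Ico_subset_Icc_self hsI)
    (intervalIntegrable_of_mem_Icc hy ha hs')
    (intervalIntegrable_of_mem_Icc hy hs' ⟨ha.1.trans hlt.le, hb⟩)
    (fun t ht => abs_sub_left_endpoint_le_omegaMod hbdd hj ht)
  have hL : ((j : ℝ) + 1) / 2 ^ n - j / 2 ^ n = 1 / 2 ^ n := by ring
  calc _ ≤ |S2 n p (j / 2 ^ n)| *
        (((j + 1) / 2 ^ n - j / 2 ^ n) * omegaMod n y / 2) := by gcongr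
    _ = |S2 n p (j / 2 ^ n)| / 2 ^ n * (omegaMod n y / 2) := by rw [hL]; ring
    _ ≤ |S2 n p (j / 2 ^ n)| / 2 ^ n * omegaMod n y := by gcongr; linarith
    _ ≤ M * omegaMod n y := by gcongr; exact hM j hj

/-- Partial sums of order `2 ^ n` do not increase uniform bounds. -/
lemma abs_S2_le_of_abs_le {f : ℝ → ℝ} (hf : IntegrableOn f (Set.Ico (0 : ℝ) 1)) {C : ℝ}
    (hC : ∀ t ∈ Set.Ico (0 : ℝ) 1, |f t| ≤ C) (n : ℕ) {x : ℝ} (hx : x ∈ Set.Ico (0 : ℝ) 1) :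
    |S2 n f x| ≤ C := by
  have hj := floor_lt_two_pow n hx
  rw [S2_eq_integral hf hj (mem_Ico_floor n hx.1)]
  generalize ⌊x * 2 ^ n⌋₊ = j at *
  have hlt : (j : ℝ) / 2 ^ n < (j + 1) / 2 ^ n := by gcongr; linarith
  have hL : ((j : ℝ) + 1) / 2 ^ n - j / 2 ^ n = 1 / 2 ^ n := by ring
  have hne : ∀ᵐ t : ℝ, t ≠ (j + 1) / 2 ^ n := by simp [ae_iff]
  have key : |∫ t in ((j : ℝ) / 2 ^ n)..((j + 1) / 2 ^ n), f t| ≤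
      C * |((j : ℝ) + 1) / 2 ^ n - j / 2 ^ n| := by
    rw [← Real.norm_eq_abs]
    refine intervalIntegral.norm_integral_le_of_norm_le_const_ae ?_
    filter_upwards [hne] with t htb ht
    rw [Set.uIoc_of_le hlt.le] at ht
    exact hC t (dyadic_Ico_subset hj ⟨ht.1.le, lt_of_le_of_ne ht.2 htb⟩)
  rw [hL, abs_of_pos (show (0 : ℝ) < 1 / 2 ^ n by positivity)] at key
  rw [abs_mul, abs_of_pos (show (0 : ℝ) < 2 ^ n by positivity)]
  calc _ ≤ 2 ^ n * (C * (1 / 2 ^ n)) := by gcongr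
    _ = C := by field_simp

/-- Estimate of `m_n^3`:
`|S_{2^n}(∫_ξ^· S_{2^n}p·(y − S_{2^n}y))(x)| ≤ 2 max_i {2^{-n}|S_{2^n}p(i/2^n)|} · ω_n y`. -/
theorem estimate_mn3 (p y : ℝ → ℝ)
    (hpi : IntegrableOn p (Set.Ico (0:ℝ) 1))
    (hyi : IntegrableOn y (Set.Ico (0:ℝ) 1))
    (n : ℕ) (hn : 1 ≤ n) (hybdd : BddAbove (modSet n y))
    (ξ : ℝ) (hξ : ξ ∈ Set.Ico (0:ℝ) 1) :
    ∀ x ∈ Set.Ico (0:ℝ) 1,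
      |S2 n (fun s => ∫ t in ξ..s, S2 n p t * (y t - S2 n y t)) x| ≤
        2 * ((Finset.range (2 ^ n)).sup' (Finset.nonempty_range_iff.mpr (by positivity))
              fun i => |S2 n p ((i : ℝ) / 2 ^ n)| / 2 ^ n) * omegaMod n y := by
  intro x hx
  have hg := integrableOn_S2_mul_sub_S2 p hyi n
  have h0 : (0 : ℝ) ∈ Set.Icc (0 : ℝ) 1 := ⟨le_rfl, zero_le_one⟩
  have hξ' := Set.Ico_subset_Icc_self hξ
  refine abs_S2_le_of_abs_le ?_ (fun s hs => ?_) n hx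
  · have hcont : ContinuousOn (fun s => ∫ t in ξ..s, S2 n p t * (y t - S2 n y t))
        (Set.uIcc 0 1) := by
      refine intervalIntegral.continuousOn_primitive_interval' (b₁ := 0) (b₂ := 1)
        (intervalIntegrable_of_mem_Icc hg h0 ⟨zero_le_one, le_rfl⟩) ?_
      rwa [Set.uIcc_of_le zero_le_one]
    rw [Set.uIcc_of_le zero_le_one] at hcont
    exact hcont.integrableOn_Icc.mono_set Set.Ico_subset_Icc_self
  · have hM : ∀ i : ℕ, i < 2 ^ n → |S2 n p ((i : ℝ) / 2 ^ n)| / 2 ^ n ≤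
        (Finset.range (2 ^ n)).sup' (Finset.nonempty_range_iff.mpr (by positivity))
          fun i => |S2 n p ((i : ℝ) / 2 ^ n)| / 2 ^ n := fun i hi =>
      Finset.le_sup' (fun i : ℕ => |S2 n p ((i : ℝ) / 2 ^ n)| / 2 ^ n) (Finset.mem_range.mpr hi)
    have hs0 := abs_integral_S2_mul_sub_S2_le hpi hyi hybdd hM hs
    have hξ0 := abs_integral_S2_mul_sub_S2_le hpi hyi hybdd hM hξ
    rw [← intervalIntegral.integral_interval_sub_left
      (intervalIntegrable_of_mem_Icc hg h0 (Set.Ico_subset_Icc_self hs))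
      (intervalIntegrable_of_mem_Icc hg h0 hξ')]
    refine (abs_sub _ _).trans ?_
    linarith
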